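/- Assume the curling number conjecture: every finite nonempty integer sequence has finite tail length. Let S_0 be a finite nonempty integer sequence that does not contain the term 1, let S^{(e)} be its extension, and let S^{(∞)} be its infinite continuation. Then S^{(∞)} equals the concatenation of S^{(e)} with Gijswijt's sequence G. -/

import Mathlib

/-- `listPow Y k` is the sequence `Y` repeated `k` times (i.e. `Y^k`). -/
def listPow {α : Type*} (Y : List α) : ℕ → List α
  | 0 => []
  | k + 1 => Y ++ listPow Y k

/-- The curling number of a finite sequence `S`: the largest `k` such that
`S = X ++ Y^k` for some (possibly empty) `X` and nonempty `Y`. -/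
noncomputable def CN {α : Type*} (S : List α) : ℕ :=
  sSup {k | ∃ X Y : List α, Y ≠ [] ∧ S = X ++ listPow Y k}

/-- A nonempty sequence is primitive if it is not a power `T^i` with `i ≥ 2`. -/
def Primitive {α : Type*} (S : List α) : Prop :=
  S ≠ [] ∧ ∀ (T : List α) (i : ℕ), 2 ≤ i → S ≠ listPow T i

/-- `T` is a proper suffix of `S`: a suffix which is strictly shorter than `S`. -/
def ProperSuffix {α : Type*} (T S : List α) : Prop := T <:+ S ∧ T.length < S.length

/-- A sequence `S` with curling number `k` is robust if no proper suffix of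
`S^(k+1)` has curling number `≥ k + 1`. -/
def Robust {α : Type*} (S : List α) : Prop :=
  ∀ T : List α, ProperSuffix T (listPow S (CN S + 1)) → CN T ≤ CN S

/-- One step of the curling process: append the curling number of `S` to `S`. -/
noncomputable def nextSeq (S : List ℤ) : List ℤ := S ++ [(CN S : ℤ)]

/-- The infinite continuation of a starting sequence `S`: the `j`-th term (0-indexed)
of the infinite sequence obtained by repeatedly appending curling numbers. -/
noncomputable def contSeq (S : List ℤ) (j : ℕ) : ℤ := (nextSeq^[j + 1] S).getD j 0

/-- Gijswijt's sequence: the infinite continuation of the one-term sequence `1`. -/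
noncomputable def Gijswijt : ℕ → ℤ := contSeq [1]

theorem length_listPow {α : Type*} (Y : List α) (k : ℕ) :
    (listPow Y k).length = k * Y.length := by
  induction k with
  | zero => simp [listPow]
  | succ k ih => simp [listPow, ih]; ring

theorem mem_of_mem_listPow {α : Type*} {Y : List α} {k : ℕ} {a : α}
    (h : a ∈ listPow Y k) : a ∈ Y := by
  induction k with
  | zero => simp [listPow] at h
  | succ k ih =>
    rcases List.mem_append.1 h with h | h
    · exact h
    · exact ih h

theorem bddAbove_curling {α : Type*} (S : List α) :
    BddAbove {k | ∃ X Y : List α, Y ≠ [] ∧ S = X ++ listPow Y k} := by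
  refine ⟨S.length, ?_⟩
  rintro k ⟨X, Y, hY, rfl⟩
  rw [List.length_append, length_listPow]
  have := Nat.le_mul_of_pos_right k (List.length_pos_iff.2 hY)
  omega

theorem le_CN {α : Type*} {X Y : List α} {k : ℕ} (hY : Y ≠ []) :
    k ≤ CN (X ++ listPow Y k) :=
  le_csSup (bddAbove_curling _) ⟨X, Y, hY, rfl⟩

theorem CN_le {α : Type*} {S : List α} {n : ℕ} (hS : S ≠ [])
    (h : ∀ (X Y : List α) (k : ℕ), Y ≠ [] → S = X ++ listPow Y k → k ≤ n) : CN S ≤ n := by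
  refine csSup_le ⟨0, S, S, hS, by simp [listPow]⟩ ?_
  rintro k ⟨X, Y, hY, hk⟩
  exact h X Y k hY hk

theorem exists_eq_append_listPow_CN {α : Type*} {S : List α} (hS : S ≠ []) :
    ∃ X Y : List α, Y ≠ [] ∧ S = X ++ listPow Y (CN S) :=
  Nat.sSup_mem (s := {k | ∃ X Y : List α, Y ≠ [] ∧ S = X ++ listPow Y k})
    ⟨0, S, S, hS, by simp [listPow]⟩ (bddAbove_curling S)

theorem one_le_CN {α : Type*} {S : List α} (hS : S ≠ []) : 1 ≤ CN S := by
  simpa [listPow] using le_CN (X := []) (k := 1) hS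

theorem CN_le_CN_append {α : Type*} (P : List α) {S : List α} (hS : S ≠ []) :
    CN S ≤ CN (P ++ S) := by
  obtain ⟨X, Y, hY, h⟩ := exists_eq_append_listPow_CN hS
  have := le_CN (X := P ++ X) (k := CN S) hY
  rwa [List.append_assoc, ← h] at this

theorem length_iterate_nextSeq (S : List ℤ) (m : ℕ) :
    (nextSeq^[m] S).length = S.length + m := by
  induction m with
  | zero => rfl
  | succ m ih => simp [Function.iterate_succ_apply', nextSeq, ih]; ring

theorem iterate_nextSeq_prefix (S : List ℤ) {a b : ℕ} (h : a ≤ b) :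
    nextSeq^[a] S <+: nextSeq^[b] S := by
  induction b, h using Nat.le_induction with
  | base => exact List.prefix_rfl
  | succ b _ ih =>
    rw [Function.iterate_succ_apply']
    exact ih.trans (List.prefix_append _ _)

theorem getD_iterate_nextSeq (S : List ℤ) {a b j : ℕ} (ha : j < S.length + a)
    (hb : j < S.length + b) : (nextSeq^[a] S).getD j 0 = (nextSeq^[b] S).getD j 0 := by
  wlog h : a ≤ b generalizing a b
  · exact (this hb ha (by omega)).symm
  obtain ⟨R, hR⟩ := iterate_nextSeq_prefix S h
  rw [← hR, List.getD_append _ _ _ _ (by rwa [length_iterate_nextSeq])]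

/-- Every term of a continuation beyond the starting sequence is the curling number of the
terms before it. -/
theorem eq_CN_of_iterate_nextSeq_eq {S : List ℤ} {m : ℕ} {P Q : List ℤ} {x : ℤ}
    (hP : S.length ≤ P.length) (h : nextSeq^[m] S = P ++ x :: Q) : x = CN P := by
  induction m generalizing Q with
  | zero =>
    have := congrArg List.length h
    simp at this
    omega
  | succ m ih =>
    rw [Function.iterate_succ_apply', nextSeq] at h
    rcases List.eq_nil_or_concat Q with rfl | ⟨Q', z, rfl⟩
    · obtain ⟨h1, h2⟩ := List.append_inj' h rfl
      rw [← h1]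
      simpa using h2.symm
    · rw [List.concat_eq_append, ← List.cons_append, ← List.append_assoc] at h
      exact ih (List.append_inj' h rfl).1

/-- Prefixing a sequence without `1` to a nonempty initial segment of Gijswijt's sequence
does not change the curling number. -/
theorem CN_append_iterate_nextSeq_one {E : List ℤ} (hE : (1 : ℤ) ∉ E) (m : ℕ) :
    CN (E ++ nextSeq^[m] [1]) = CN (nextSeq^[m] [1]) := by
  have hpre : [1] <+: nextSeq^[m] [1] := iterate_nextSeq_prefix [1] (Nat.zero_le m)
  obtain ⟨R, hR⟩ := hpre
  have hne : nextSeq^[m] [1] ≠ [] := by simp [← hR]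
  refine le_antisymm (CN_le (by simp [hne]) fun X Y k hY h => ?_) (CN_le_CN_append E hne)
  rcases List.append_eq_append_iff.1 h with ⟨X', -, h2⟩ | ⟨A, rfl, h2⟩
  · rw [h2]
    exact le_CN hY
  rcases k with _ | k
  · exact Nat.zero_le _
  rcases k with _ | k
  · exact one_le_CN hne
  rw [listPow] at h2
  rcases A with _ | ⟨a, A⟩
  · rw [List.nil_append] at h2
    rw [← h2]
    exact le_CN (X := []) (k := k + 2) hY
  have hG1 : (1 : ℤ) ∈ nextSeq^[m] [1] := by simp [← hR]
  have ha : a ≠ 1 := by rintro rfl; simp at hE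
  rcases List.append_eq_append_iff.1 h2 with ⟨C, hA, hC⟩ | ⟨B, rfl, hB⟩
  · have h1 : (1 : ℤ) ∈ Y := mem_of_mem_listPow (k := k + 1) (by simp [hC, hG1])
    exact absurd (by simp [hA, h1]) hE
  rcases B with _ | ⟨b, B⟩
  · rw [List.nil_append] at hB
    have h1 := mem_of_mem_listPow (hB ▸ hG1)
    exact absurd (List.mem_append_right X (by simpa using h1)) hE
  obtain rfl : b = 1 := by
    rw [hB] at hR
    simpa using (List.cons.inj hR).1.symm
  -- Gijswijt's sequence now starts with `B A B …`, where `A` has no `1` and `B` starts with `1`.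
  have hBA : a = CN (1 :: B) :=
    eq_CN_of_iterate_nextSeq_eq (Q := A ++ 1 :: B ++ listPow (a :: A ++ 1 :: B) k) (by simp)
      (hB.trans (by simp [listPow]))
  rcases k with _ | k
  · have h1 := one_le_CN (S := 1 :: B) (by simp)
    have h3 := CN_le_CN_append ((1 :: B) ++ (a :: A)) (S := 1 :: B) (by simp)
    rw [hB]
    simp only [listPow, List.append_nil, ← List.append_assoc] at h3 ⊢
    have h4 : CN (1 :: B) ≠ 1 := fun h => ha (by simp [hBA, h])
    omega
  · have h1 : (1 : ℤ) = CN (listPow ((1 :: B) ++ (a :: A)) 2) :=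
      eq_CN_of_iterate_nextSeq_eq (Q := B ++ listPow (a :: A ++ 1 :: B) k) (by simp [listPow])
        (hB.trans (by simp [listPow]))
    have h3 := le_CN (X := []) (Y := (1 :: B) ++ (a :: A)) (k := 2) (by simp)
    rw [List.nil_append] at h3
    omega

/-- Assuming the curling number conjecture, if the starting sequence `S₀` contains no `1`,
then its infinite continuation is its extension `S^(e)` followed by Gijswijt's sequence. -/
theorem thJoin
    (hConj : ∀ S : List ℤ, S ≠ [] → ∃ t : ℕ, CN (nextSeq^[t] S) = 1)
    (S₀ : List ℤ) (h0 : S₀ ≠ []) (hno1 : (1 : ℤ) ∉ S₀)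
    (t : ℕ) (ht : CN (nextSeq^[t] S₀) = 1)
    (htmin : ∀ t' : ℕ, t' < t → CN (nextSeq^[t'] S₀) ≠ 1) :
    ∀ j : ℕ, contSeq S₀ j =
      if j < (nextSeq^[t] S₀).length then (nextSeq^[t] S₀).getD j 0
      else Gijswijt (j - (nextSeq^[t] S₀).length) := by
  have hE : ∀ s ≤ t, (1 : ℤ) ∉ nextSeq^[s] S₀ := by
    intro s hs
    induction s with
    | zero => exact hno1
    | succ s ih =>
      rw [Function.iterate_succ_apply', nextSeq, List.mem_append, List.mem_singleton]
      rintro (h | h)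
      · exact ih (by omega) h
      · exact htmin s hs (by exact_mod_cast h.symm)
  have hjoin : ∀ m, nextSeq^[m + 1 + t] S₀ = nextSeq^[t] S₀ ++ nextSeq^[m] [1] := by
    intro m
    induction m with
    | zero => simp [Nat.add_comm 1 t, Function.iterate_succ_apply', nextSeq, ht]
    | succ m ih =>
      rw [Nat.add_right_comm, Function.iterate_succ_apply', ih, nextSeq,
        CN_append_iterate_nextSeq_one (hE t le_rfl), List.append_assoc,
        Function.iterate_succ_apply', nextSeq]
  have hpos := List.length_pos_iff.2 h0
  have hlen := length_iterate_nextSeq S₀ t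
  intro j
  split_ifs with hj
  · exact getD_iterate_nextSeq S₀ (by omega) (by omega)
  · obtain ⟨m, rfl⟩ : ∃ m, j = m + t := ⟨j - t, by omega⟩
    rw [contSeq, Nat.add_right_comm, hjoin, List.getD_append_right _ _ _ _ (by omega)]
    exact getD_iterate_nextSeq [1] (by simp; omega) (by simp; omega)
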